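/- The diagonal recursion coefficients of the monic orthogonal polynomials with respect to weight 1-t on [0,1] are \alpha_n = \frac{2n^2 - 1}{4n^2 - 1} for n \ge 1, where \alpha_{n} = \int_0^1 t\, p_{n-1}(t)^2 (1-t)\,dt \Big/ \int_0^1 p_{n-1}(t)^2 (1-t)\,dt. -/

import Mathlib

open Polynomial MeasureTheory

/-- Falling factorial `c(c-1)⋯(c-m+1)` for real `c`. -/
noncomputable def fallFac (c : ℝ) (m : ℕ) : ℝ := ∏ i ∈ Finset.range m, (c - i)

/-- The identity-type polynomial `e_n(t) = ∑_{m=0}^n ((n)_m (-n)_m / (m!)^2) t^m`. -/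
noncomputable def idPoly (n : ℕ) : Polynomial ℝ :=
  ∑ m ∈ Finset.range (n + 1),
    Polynomial.C (fallFac (n : ℝ) m * fallFac (-(n : ℝ)) m / ((Nat.factorial m : ℝ)) ^ 2) *
      Polynomial.X ^ m

/-- The leading coefficient `κ_n = (-1)^n (2n-1)!/(n!(n-1)!)` of `e_n`. -/
noncomputable def kappa (n : ℕ) : ℝ :=
  (-1 : ℝ) ^ n * (Nat.factorial (2 * n - 1) : ℝ) /
    ((Nat.factorial n : ℝ) * (Nat.factorial (n - 1) : ℝ))

theorem fallFac_natCast (n m : ℕ) :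
    fallFac (n : ℝ) m = (m.factorial : ℝ) * (n.choose m : ℝ) := by
  rw [← Nat.cast_mul, ← Nat.descFactorial_eq_factorial_mul_choose, fallFac]
  induction m with
  | zero => simp
  | succ m ih =>
    rw [Finset.prod_range_succ, ih, Nat.descFactorial_succ, Nat.cast_mul]
    rcases le_or_gt m n with h | h
    · rw [Nat.cast_sub h]; ring
    · simp [Nat.descFactorial_eq_zero_iff_lt.mpr h]

theorem fallFac_neg_natCast (n m : ℕ) :
    fallFac (-((n + 1 : ℕ) : ℝ)) m =
      (-1) ^ m * ((m.factorial : ℝ) * ((n + m).choose m : ℝ)) := by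
  rw [← Nat.cast_mul, ← Nat.ascFactorial_eq_factorial_mul_choose, fallFac]
  induction m with
  | zero => simp
  | succ m ih =>
    rw [Finset.prod_range_succ, ih, Nat.ascFactorial_succ]
    push_cast
    ring

theorem coeff_idPoly_succ (n k : ℕ) :
    (idPoly (n + 1)).coeff k =
      (-1) ^ k * ((n + 1).choose k : ℝ) * ((n + k).choose k : ℝ) := by
  have hk : (k.factorial : ℝ) ≠ 0 := by positivity
  rw [idPoly, finsetSum_coeff]
  simp_rw [coeff_C_mul_X_pow, fallFac_natCast, fallFac_neg_natCast]
  rw [Finset.sum_ite_eq]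
  split_ifs with h
  · field_simp
  · rw [Finset.mem_range, not_lt] at h
    rw [Nat.choose_eq_zero_of_lt (by omega : n + 1 < k)]
    simp

/-- The shifted Legendre polynomial with real coefficients. -/
noncomputable def realLegendre (n : ℕ) : ℝ[X] :=
  (shiftedLegendre n).map (Int.castRingHom ℝ)

theorem two_mul_idPoly_succ (n : ℕ) :
    2 * idPoly (n + 1) = realLegendre (n + 1) + realLegendre n := by
  ext k
  rw [show (2 : ℝ[X]) = C 2 from rfl, coeff_C_mul, coeff_add, coeff_idPoly_succ, realLegendre,
    realLegendre, coeff_map, coeff_map, coeff_shiftedLegendre, coeff_shiftedLegendre]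
  simp only [eq_intCast]
  push_cast
  have h1 : ((n + k + 1 : ℕ) : ℝ) * ((n + k).choose n : ℝ) =
      ((n + k + 1).choose (n + 1) : ℝ) * ((n + 1 : ℕ) : ℝ) := by
    exact_mod_cast Nat.add_one_mul_choose_eq (n + k) n
  have h2 : (n.choose k : ℝ) * (n + 1) = ((n + 1).choose k : ℝ) * (n + 1 - k) := by
    rcases le_or_gt k (n + 1) with h | h
    · have := congrArg (Nat.cast (R := ℝ)) (Nat.choose_mul_succ_eq n k)
      rw [Nat.cast_mul, Nat.cast_mul, Nat.cast_sub h] at this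
      exact_mod_cast this
    · simp [Nat.choose_eq_zero_of_lt h, Nat.choose_eq_zero_of_lt (by omega : n < k)]
  rw [show n + 1 + k = n + k + 1 by ring, ← Nat.choose_symm_add]
  push_cast at h1
  have hn : (n + 1 : ℝ) ≠ 0 := by positivity
  apply mul_left_cancel₀ hn
  linear_combination (-1 : ℝ) ^ k * ((n + 1).choose k : ℝ) * h1 -
    (-1 : ℝ) ^ k * ((n + k).choose n : ℝ) * h2

/-- Integration of real polynomials over the unit interval. -/
noncomputable def unitIntegral : ℝ[X] →ₗ[ℝ] ℝ where
  toFun p := ∫ t in (0 : ℝ)..1, p.eval t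
  map_add' p q := by
    simp only [eval_add]
    exact intervalIntegral.integral_add (p.continuous.intervalIntegrable _ _)
      (q.continuous.intervalIntegrable _ _)
  map_smul' c p := by simp

theorem unitIntegral_apply (p : ℝ[X]) : unitIntegral p = ∫ t in (0 : ℝ)..1, p.eval t := rfl

theorem unitIntegral_C_mul (c : ℝ) (p : ℝ[X]) :
    unitIntegral (C c * p) = c * unitIntegral p := by
  rw [← smul_eq_C_mul, map_smul, smul_eq_mul]

theorem unitIntegral_derivative (p : ℝ[X]) :
    unitIntegral (derivative p) = p.eval 1 - p.eval 0 :=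
  intervalIntegral.integral_eq_sub_of_hasDerivAt (fun x _ ↦ p.hasDerivAt x)
    ((derivative p).continuous.intervalIntegrable _ _)

theorem unitIntegral_iterate_derivative_mul (n : ℕ) (g : ℝ[X]) {k : ℕ} (hk : k ≤ n) :
    unitIntegral (derivative^[k] ((X * (1 - X)) ^ n) * g) =
      (-1) ^ k * unitIntegral ((X * (1 - X)) ^ n * derivative^[k] g) := by
  induction k generalizing g with
  | zero => simp
  | succ k ih =>
    obtain ⟨r, hr⟩ := pow_sub_dvd_iterate_derivative_pow (X * (1 - X) : ℝ[X]) n k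
    have hnk : n - k ≠ 0 := by omega
    have h := unitIntegral_derivative (derivative^[k] ((X * (1 - X)) ^ n) * g)
    rw [derivative_mul, map_add, ← Function.iterate_succ_apply' derivative,
      ih (derivative g) (by omega), ← Function.iterate_succ_apply derivative, hr] at h
    simp only [eval_mul, eval_pow, eval_sub, eval_X, eval_one, sub_self, mul_zero, zero_mul,
      zero_pow hnk] at h
    rw [pow_succ]
    linarith

theorem factorial_mul_unitIntegral_realLegendre_mul (n : ℕ) (g : ℝ[X]) :
    (n.factorial : ℝ) * unitIntegral (realLegendre n * g) =
      (-1) ^ n * unitIntegral ((X * (1 - X)) ^ n * derivative^[n] g) := by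
  rw [← unitIntegral_iterate_derivative_mul n g le_rfl, ← unitIntegral_C_mul, ← mul_assoc]
  have h := congrArg (Polynomial.map (Int.castRingHom ℝ)) (factorial_mul_shiftedLegendre_eq n)
  rw [← iterate_derivative_map, Polynomial.map_mul] at h
  simp only [Polynomial.map_mul, Polynomial.map_pow, Polynomial.map_sub, map_X,
    Polynomial.map_one, Polynomial.map_natCast] at h
  rw [mul_pow, ← h, realLegendre, map_natCast]

theorem iterate_derivative_of_natDegree_le_succ {n : ℕ} {g : ℝ[X]} (hg : g.natDegree ≤ n + 1) :
    derivative^[n] g = C ((n.factorial : ℝ) * g.coeff n) +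
      C (((n + 1).factorial : ℝ) * g.coeff (n + 1)) * X := by
  ext k
  rw [coeff_iterate_derivative, coeff_add, coeff_C, coeff_C_mul, coeff_X]
  match k with
  | 0 => simp [Nat.descFactorial_self]
  | 1 =>
    have h : (n + 1).descFactorial n = (n + 1).factorial := by
      simpa using Nat.factorial_mul_descFactorial (Nat.le_succ n)
    simp [add_comm 1 n, h]
  | k + 2 => simp [coeff_eq_zero_of_natDegree_lt (show g.natDegree < k + 2 + n by omega)]

theorem unitIntegral_pow_mul_X (n : ℕ) :
    2 * unitIntegral ((X * (1 - X)) ^ n * X) = unitIntegral ((X * (1 - X)) ^ n) := by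
  have h := unitIntegral_derivative ((X * (1 - X)) ^ (n + 1))
  have e : derivative ((X * (1 - X) : ℝ[X]) ^ (n + 1)) =
      C (n + 1 : ℝ) * ((X * (1 - X)) ^ n - C 2 * ((X * (1 - X)) ^ n * X)) := by
    simp [derivative_pow, map_ofNat C]
    ring
  rw [e, unitIntegral_C_mul, map_sub, unitIntegral_C_mul] at h
  simp only [eval_mul, eval_pow, eval_sub, eval_X, eval_one, sub_self, mul_zero, zero_mul,
    zero_pow n.succ_ne_zero] at h
  have hn : (n + 1 : ℝ) ≠ 0 := by positivity
  linarith [(mul_eq_zero.mp h).resolve_left hn]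

theorem unitIntegral_pow_succ (n : ℕ) :
    2 * (2 * n + 3) * unitIntegral ((X * (1 - X)) ^ (n + 1)) =
      (n + 1) * unitIntegral ((X * (1 - X)) ^ n) := by
  have h := unitIntegral_derivative ((2 * X - 1) * (X * (1 - X)) ^ (n + 1))
  have e : derivative ((2 * X - 1) * (X * (1 - X) : ℝ[X]) ^ (n + 1)) =
      C (2 * (2 * n + 3) : ℝ) * (X * (1 - X)) ^ (n + 1) -
        C (n + 1 : ℝ) * (X * (1 - X)) ^ n := by
    simp [derivative_pow, map_ofNat C]
    ring
  rw [e, map_sub, unitIntegral_C_mul, unitIntegral_C_mul] at h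
  simp only [eval_mul, eval_pow, eval_sub, eval_X, eval_one, sub_self, mul_zero, zero_mul,
    zero_pow n.succ_ne_zero] at h
  linarith

theorem unitIntegral_pow_pos (n : ℕ) : 0 < unitIntegral ((X * (1 - X)) ^ n) := by
  induction n with
  | zero => simp [unitIntegral_apply]
  | succ n ih =>
    have h := unitIntegral_pow_succ n
    have : 0 < (n + 1 : ℝ) * unitIntegral ((X * (1 - X)) ^ n) := by positivity
    rw [← h] at this
    exact pos_of_mul_pos_right this (by positivity)

theorem unitIntegral_realLegendre_mul {n : ℕ} {g : ℝ[X]} (hg : g.natDegree ≤ n + 1) :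
    unitIntegral (realLegendre n * g) =
      (-1) ^ n * (g.coeff n + (n + 1) / 2 * g.coeff (n + 1)) *
        unitIntegral ((X * (1 - X)) ^ n) := by
  have hf : (n.factorial : ℝ) ≠ 0 := by positivity
  apply mul_left_cancel₀ hf
  rw [factorial_mul_unitIntegral_realLegendre_mul, iterate_derivative_of_natDegree_le_succ hg,
    mul_add, mul_left_comm, map_add, unitIntegral_C_mul, mul_comm _ (C _), unitIntegral_C_mul,
    ← unitIntegral_pow_mul_X, Nat.factorial_succ]
  push_cast
  ring

theorem kappa_ne_zero (n : ℕ) : kappa n ≠ 0 := by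
  rw [kappa]
  positivity

theorem two_mul_add_one_mul_coeff_idPoly (n : ℕ) :
    (2 * n + 1) * (idPoly (n + 1)).coeff n =
      -(n + 1) ^ 2 * (idPoly (n + 1)).coeff (n + 1) := by
  have h : ((n + n + 1 : ℕ) : ℝ) * ((n + n).choose n : ℝ) =
      ((n + n + 1).choose (n + 1) : ℝ) * ((n + 1 : ℕ) : ℝ) := by
    exact_mod_cast Nat.add_one_mul_choose_eq (n + n) n
  rw [coeff_idPoly_succ, coeff_idPoly_succ, Nat.choose_succ_self_right, Nat.choose_self,
    ← add_assoc]
  push_cast at h ⊢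
  linear_combination (-1 : ℝ) ^ n * (n + 1) * h

theorem coeff_idPoly_succ_self_ne_zero (n : ℕ) : (idPoly (n + 1)).coeff (n + 1) ≠ 0 := by
  have : ((n + (n + 1)).choose (n + 1) : ℝ) ≠ 0 :=
    Nat.cast_ne_zero.mpr (Nat.choose_pos (by omega)).ne'
  simp [coeff_idPoly_succ, this]

theorem natDegree_idPoly_succ_le (n : ℕ) : (idPoly (n + 1)).natDegree ≤ n + 1 := by
  rw [natDegree_le_iff_coeff_eq_zero]
  intro k hk
  simp [coeff_idPoly_succ, Nat.choose_eq_zero_of_lt hk]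

theorem two_mul_unitIntegral_idPoly_mul (n : ℕ) (g : ℝ[X]) :
    2 * unitIntegral (idPoly (n + 1) * g) =
      unitIntegral (realLegendre (n + 1) * g) + unitIntegral (realLegendre n * g) := by
  rw [← unitIntegral_C_mul, ← map_add, ← add_mul, ← two_mul_idPoly_succ, mul_assoc]
  rfl

theorem alpha_coefficient (n : ℕ) (hn : 0 < n) (q : Polynomial ℝ)
    (hq : idPoly n = (1 - Polynomial.X) * q) :
    (∫ t in (0:ℝ)..1, t * ((Polynomial.C (-(kappa n)⁻¹) * q).eval t) ^ 2 * (1 - t)) /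
      (∫ t in (0:ℝ)..1, ((Polynomial.C (-(kappa n)⁻¹) * q).eval t) ^ 2 * (1 - t)) =
      (2 * (n : ℝ) ^ 2 - 1) / (4 * (n : ℝ) ^ 2 - 1) := by
  have hc : (-(kappa n)⁻¹) ^ 2 ≠ 0 :=
    pow_ne_zero _ (neg_ne_zero.mpr (inv_ne_zero (kappa_ne_zero n)))
  have hnum : (∫ t in (0:ℝ)..1, t * ((C (-(kappa n)⁻¹) * q).eval t) ^ 2 * (1 - t)) =
      (-(kappa n)⁻¹) ^ 2 * unitIntegral (idPoly n * (X * q)) := by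
    rw [← unitIntegral_C_mul, unitIntegral_apply, hq]
    congr 1 with t
    simp
    ring
  have hden : (∫ t in (0:ℝ)..1, ((C (-(kappa n)⁻¹) * q).eval t) ^ 2 * (1 - t)) =
      (-(kappa n)⁻¹) ^ 2 * unitIntegral (idPoly n * q) := by
    rw [← unitIntegral_C_mul, unitIntegral_apply, hq]
    congr 1 with t
    simp
    ring
  rw [hnum, hden, mul_div_mul_left _ _ hc]
  obtain ⟨m, rfl⟩ : ∃ m, n = m + 1 := ⟨n - 1, by omega⟩
  have hlead := coeff_idPoly_succ_self_ne_zero m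
  have hq0 : q ≠ 0 := by
    rintro rfl
    simp [hq] at hlead
  have h1X : (1 - X : ℝ[X]).natDegree = 1 := by
    rw [← natDegree_neg, neg_sub]
    exact natDegree_X_sub_C 1
  have hqdeg : q.natDegree ≤ m := by
    have h := natDegree_idPoly_succ_le m
    rw [hq, natDegree_mul (fun h ↦ by simp [h] at h1X) hq0, h1X] at h
    omega
  have hXqdeg : (X * q).natDegree ≤ m + 1 := by
    rw [natDegree_X_mul hq0]
    omega
  have hqm : q.coeff (m + 1) = 0 := coeff_eq_zero_of_natDegree_lt (by omega)
  have hqm' : q.coeff (m + 1 + 1) = 0 := coeff_eq_zero_of_natDegree_lt (by omega)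
  have htop : (idPoly (m + 1)).coeff (m + 1) = -q.coeff m := by
    rw [hq, sub_mul, one_mul, coeff_sub, coeff_X_mul, hqm, zero_sub]
  have hsub : (idPoly (m + 1)).coeff m = q.coeff m - (X * q).coeff m := by
    rw [hq, sub_mul, one_mul, coeff_sub]
  have ha : q.coeff m ≠ 0 := by
    rw [htop] at hlead
    exact neg_ne_zero.mp hlead
  have hrel := two_mul_add_one_mul_coeff_idPoly m
  rw [htop, hsub] at hrel
  have hB := unitIntegral_pow_succ m
  have hBpos := unitIntegral_pow_pos m
  have hI := two_mul_unitIntegral_idPoly_mul m q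
  rw [unitIntegral_realLegendre_mul (by omega), unitIntegral_realLegendre_mul (by omega),
    hqm, hqm'] at hI
  have hJ := two_mul_unitIntegral_idPoly_mul m (X * q)
  rw [unitIntegral_realLegendre_mul (by omega), unitIntegral_realLegendre_mul hXqdeg,
    coeff_X_mul, coeff_X_mul, hqm] at hJ
  have hs : ((-1 : ℝ) ^ m) ≠ 0 := by positivity
  have hIne : unitIntegral (idPoly (m + 1) * q) ≠ 0 := by
    intro h
    have : (-1 : ℝ) ^ m * q.coeff m * unitIntegral ((X * (1 - X)) ^ m) = 0 := by
      linear_combination 2 * h - hI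
    exact mul_ne_zero (mul_ne_zero hs ha) hBpos.ne' this
  have hd : (4 * ((m + 1 : ℕ) : ℝ) ^ 2 - 1) ≠ 0 := by
    push_cast
    nlinarith [(Nat.cast_nonneg m : (0 : ℝ) ≤ m)]
  rw [div_eq_div_iff hIne hd]
  push_cast
  generalize unitIntegral (idPoly (m + 1) * (X * q)) = J at *
  generalize unitIntegral (idPoly (m + 1) * q) = I at *
  generalize unitIntegral ((X * (1 - X)) ^ (m + 1)) = B' at *
  generalize unitIntegral ((X * (1 - X)) ^ m) = B at *
  generalize (X * q).coeff m = b at *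
  generalize q.coeff m = a at *
  rw [pow_succ] at hJ
  generalize (-1 : ℝ) ^ m = s at *
  linear_combination (4 * ((m : ℝ) + 1) ^ 2 - 1) / 2 * hJ
    - (2 * ((m : ℝ) + 1) ^ 2 - 1) / 2 * hI - s * a * (2 * m + 1) / 4 * hB
    - s * B * (2 * m + 3) / 2 * hrel
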